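/- Let K > 1, r ∈ (0,1), and let s ∈ (0,1) satisfy μ(s) = μ(r)/K (so s = φ_K(r)). Define u₁(r) = artanh((1-r²)^(1/8)) and v₂(r) = log(2(1+√(1-r²))/r). Then √(1 - tanh(u₁(r)/K)⁸) < s, and if moreover v₂(r)/K ≥ log 2, then s < 4·exp(v₂(r)/K)/(exp(2·v₂(r)/K) + 4). -/

import Mathlib

/-- Descending Landen sequence: `descL r p = L(r,-p)`. -/
noncomputable def descL (r : ℝ) : ℕ → ℝ
  | 0 => r
  | p + 1 => (descL r p / (1 + Real.sqrt (1 - (descL r p) ^ 2))) ^ 2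

/-- Ascending Landen sequence: `ascL r p = L(r,p)`. -/
noncomputable def ascL (r : ℝ) : ℕ → ℝ
  | 0 => r
  | p + 1 => 2 * Real.sqrt (ascL r p) / (1 + ascL r p)

/-- Complete elliptic integral of the first kind. -/
noncomputable def ellK (r : ℝ) : ℝ :=
  ∫ x in (0:ℝ)..1, 1 / Real.sqrt ((1 - x ^ 2) * (1 - r ^ 2 * x ^ 2))

/-- The Grötzsch modulus function `μ`. -/
noncomputable def mu (r : ℝ) : ℝ :=
  Real.pi / 2 * ellK (Real.sqrt (1 - r ^ 2)) / ellK r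

/-- Inverse hyperbolic tangent. -/
noncomputable def artanh (x : ℝ) : ℝ := Real.log ((1 + x) / (1 - x)) / 2

section

open Set Filter Topology MeasureTheory

/-- Gauss's transformation of the complete elliptic integral. -/
theorem ellK_ascending_landen {k : ℝ} (hk : k ∈ Ioo (0:ℝ) 1) :
    ellK (2 * √k / (1 + k)) = (1 + k) * ellK k := by
  obtain ⟨h0, h1⟩ := hk
  set φ : ℝ → ℝ := fun y => (1 + k) * y / (1 + k * y ^ 2) with hφ
  have hden : ∀ y : ℝ, 0 < 1 + k * y ^ 2 := fun y => by positivity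
  have hmono : StrictMonoOn φ (Icc 0 1) := by
    intro x hx y hy hxy
    simp only [hφ]
    rw [div_lt_div_iff₀ (hden x) (hden y)]
    have hxy1 : x * y ≤ 1 := mul_le_one₀ hx.2 hy.1 hy.2
    have : 0 < (1 + k) * (y - x) * (1 - k * (x * y)) := by
      have : k * (x * y) ≤ k * 1 := by gcongr
      have h2 : 0 < 1 - k * (x * y) := by linarith
      have h3 : 0 < y - x := by linarith
      positivity
    linarith
  have hφ0 : φ 0 = 0 := by simp [hφ]
  have hφ1 : φ 1 = 1 := by simp only [hφ]; field_simp
  have himg : φ '' Ioo 0 1 = Ioo 0 1 := by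
    apply Subset.antisymm
    · rintro _ ⟨y, hy, rfl⟩
      constructor
      · rw [← hφ0]; exact hmono ⟨le_rfl, zero_le_one⟩ ⟨hy.1.le, hy.2.le⟩ hy.1
      · rw [← hφ1]; exact hmono ⟨hy.1.le, hy.2.le⟩ ⟨zero_le_one, le_rfl⟩ hy.2
    · have hc : ContinuousOn φ (Icc 0 1) := by
        apply ContinuousOn.div (by fun_prop) (by fun_prop)
        intro y _; exact (hden y).ne'
      have := intermediate_value_Ioo (zero_le_one (α := ℝ)) hc
      rwa [hφ0, hφ1] at this
  have hder : ∀ y ∈ Ioo (0:ℝ) 1,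
      HasDerivWithinAt φ ((1 + k) * (1 - k * y ^ 2) / (1 + k * y ^ 2) ^ 2) (Ioo 0 1) y := by
    intro y _
    have hn : HasDerivAt (fun y : ℝ => (1 + k) * y) (1 + k) y := by
      simpa using (hasDerivAt_id y).const_mul (1 + k)
    have hd : HasDerivAt (fun y : ℝ => 1 + k * y ^ 2) (k * (2 * y)) y := by
      simpa using ((hasDerivAt_pow 2 y).const_mul k).const_add 1
    refine ((hn.div hd (hden y).ne').congr_deriv ?_).hasDerivWithinAt
    ring
  have hinj : InjOn φ (Ioo 0 1) := (hmono.mono Ioo_subset_Icc_self).injOn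
  have key := integral_image_eq_integral_abs_deriv_smul measurableSet_Ioo hder hinj
    (fun x => 1 / √((1 - x ^ 2) * (1 - (2 * √k / (1 + k)) ^ 2 * x ^ 2)))
  rw [himg] at key
  unfold ellK
  rw [intervalIntegral.integral_of_le zero_le_one, intervalIntegral.integral_of_le zero_le_one,
    integral_Ioc_eq_integral_Ioo, integral_Ioc_eq_integral_Ioo, key, ← integral_const_mul]
  refine setIntegral_congr_fun measurableSet_Ioo fun y hy => ?_
  have hy2 : y ^ 2 < 1 := by nlinarith [hy.1, hy.2]
  have hky : k * y ^ 2 < 1 := by nlinarith [hy.1, hy.2]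
  have hkky : k ^ 2 * y ^ 2 < 1 := by nlinarith [sq_nonneg y]
  have hD := hden y
  have hsq : (2 * √k / (1 + k)) ^ 2 = 4 * k / (1 + k) ^ 2 := by
    rw [div_pow, mul_pow, Real.sq_sqrt h0.le]; norm_num
  have e : (1 - φ y ^ 2) * (1 - (2 * √k / (1 + k)) ^ 2 * φ y ^ 2)
      = ((1 - k * y ^ 2) / (1 + k * y ^ 2) ^ 2) ^ 2 * ((1 - y ^ 2) * (1 - k ^ 2 * y ^ 2)) := by
    rw [hsq]; simp only [hφ]; field_simp; ring
  have hpos : 0 < 1 - k * y ^ 2 := by linarith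
  have hA : 0 < (1 - y ^ 2) * (1 - k ^ 2 * y ^ 2) := mul_pos (by linarith) (by linarith)
  have hB := Real.sqrt_pos.2 hA
  simp only [smul_eq_mul]
  rw [e, Real.sqrt_mul (sq_nonneg _), Real.sqrt_sq (by positivity), abs_of_pos (by positivity)]
  field_simp

theorem hasDerivAt_arcsin_Ioo {x : ℝ} (hx : x ∈ Ioo (0:ℝ) 1) :
    HasDerivAt Real.arcsin (1 / √(1 - x ^ 2)) x :=
  Real.hasDerivAt_arcsin (by linarith [hx.1]) hx.2.ne

theorem intervalIntegrable_one_div_sqrt_one_sub_sq :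
    IntervalIntegrable (fun x : ℝ => 1 / √(1 - x ^ 2)) volume 0 1 :=
  intervalIntegral.intervalIntegrable_deriv_of_nonneg Real.continuous_arcsin.continuousOn
    (fun x hx => hasDerivAt_arcsin_Ioo (by simpa using hx)) (fun _ _ => by positivity)

theorem integral_one_div_sqrt_one_sub_sq : ∫ x in (0:ℝ)..1, 1 / √(1 - x ^ 2) = Real.pi / 2 := by
  rw [intervalIntegral.integral_eq_sub_of_hasDerivAt_of_le zero_le_one
    Real.continuous_arcsin.continuousOn (fun x hx => hasDerivAt_arcsin_Ioo hx)
    intervalIntegrable_one_div_sqrt_one_sub_sq]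
  simp

theorem one_sub_sq_mul_sq_mem {r x : ℝ} (hr : r ∈ Ioo (0:ℝ) 1) (hx : x ∈ Icc (0:ℝ) 1) :
    1 - r ^ 2 ≤ 1 - r ^ 2 * x ^ 2 ∧ 1 - r ^ 2 * x ^ 2 ≤ 1 ∧ 0 < 1 - r ^ 2 := by
  have h1 : x ^ 2 ≤ 1 := by nlinarith [hx.1, hx.2]
  have h2 : r ^ 2 < 1 := by nlinarith [hr.1, hr.2]
  refine ⟨by nlinarith [sq_nonneg r], by nlinarith [mul_nonneg (sq_nonneg r) (sq_nonneg x)],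
    by linarith⟩

theorem ellK_integrand_le {r x : ℝ} (hr : r ∈ Ioo (0:ℝ) 1) (hx : x ∈ Icc (0:ℝ) 1) :
    1 / √((1 - x ^ 2) * (1 - r ^ 2 * x ^ 2)) ≤ 1 / √(1 - r ^ 2) * (1 / √(1 - x ^ 2)) := by
  obtain ⟨h1, h2, h3⟩ := one_sub_sq_mul_sq_mem hr hx
  have hx2 : 0 ≤ 1 - x ^ 2 := by nlinarith [hx.1, hx.2]
  rw [Real.sqrt_mul hx2, one_div_mul_one_div, mul_comm (√(1 - r ^ 2))]
  rcases hx2.eq_or_lt with h | h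
  · simp [← h]
  · gcongr

theorem intervalIntegrable_ellK {r : ℝ} (hr : r ∈ Ioo (0:ℝ) 1) :
    IntervalIntegrable (fun x : ℝ => 1 / √((1 - x ^ 2) * (1 - r ^ 2 * x ^ 2))) volume 0 1 := by
  refine (intervalIntegrable_one_div_sqrt_one_sub_sq.const_mul (1 / √(1 - r ^ 2))).mono_fun
    (Measurable.aestronglyMeasurable (by fun_prop)) ?_
  refine (ae_restrict_mem measurableSet_uIoc).mono fun x hx => ?_
  rw [uIoc_of_le zero_le_one] at hx
  beta_reduce
  rw [Real.norm_of_nonneg (by positivity), Real.norm_of_nonneg (by positivity)]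
  exact ellK_integrand_le hr ⟨hx.1.le, hx.2⟩

theorem ellK_le {r : ℝ} (hr : r ∈ Ioo (0:ℝ) 1) : ellK r ≤ 1 / √(1 - r ^ 2) * (Real.pi / 2) := by
  rw [← integral_one_div_sqrt_one_sub_sq, ← intervalIntegral.integral_const_mul]
  exact intervalIntegral.integral_mono_on zero_le_one (intervalIntegrable_ellK hr)
    (intervalIntegrable_one_div_sqrt_one_sub_sq.const_mul _) fun x hx => ellK_integrand_le hr hx

theorem pi_div_two_le_ellK {r : ℝ} (hr : r ∈ Ioo (0:ℝ) 1) : Real.pi / 2 ≤ ellK r := by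
  rw [← integral_one_div_sqrt_one_sub_sq]
  refine intervalIntegral.integral_mono_on zero_le_one intervalIntegrable_one_div_sqrt_one_sub_sq
    (intervalIntegrable_ellK hr) fun x hx => ?_
  obtain ⟨h1, h2, h3⟩ := one_sub_sq_mul_sq_mem hr hx
  have hx2 : 0 ≤ 1 - x ^ 2 := by nlinarith [hx.1, hx.2]
  rcases hx2.eq_or_lt with h | h
  · simp [← h]
  · have : 0 < 1 - r ^ 2 * x ^ 2 := by linarith
    gcongr
    nlinarith

theorem ellK_pos {r : ℝ} (hr : r ∈ Ioo (0:ℝ) 1) : 0 < ellK r :=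
  Real.pi_div_two_pos.trans_le (pi_div_two_le_ellK hr)

theorem ellK_le_ellK {r s : ℝ} (hr : r ∈ Ioo (0:ℝ) 1) (hs : s ∈ Ioo (0:ℝ) 1) (hrs : r ≤ s) :
    ellK r ≤ ellK s := by
  refine intervalIntegral.integral_mono_on zero_le_one (intervalIntegrable_ellK hr)
    (intervalIntegrable_ellK hs) fun x hx => ?_
  obtain ⟨h1, h2, h3⟩ := one_sub_sq_mul_sq_mem hs hx
  have hx2 : 0 ≤ 1 - x ^ 2 := by nlinarith [hx.1, hx.2]
  rcases hx2.eq_or_lt with h | h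
  · simp [← h]
  · have : 0 < 1 - s ^ 2 * x ^ 2 := by linarith
    have := hr.1
    gcongr

theorem ellK_bounds_log {k : ℝ} (hk : k ∈ Ioo (0:ℝ) 1) :
    (Real.log (1 + k) - Real.log (√(1 - k ^ 2))) / k ≤ ellK k ∧
      ellK k ≤ (Real.log (1 + k) - Real.log (√(1 - k ^ 2))) / k + 1 := by
  have hk0 := hk.1
  have hk1 : 0 < 1 - k ^ 2 := by nlinarith [hk.1, hk.2]
  set F : ℝ → ℝ := fun x => -(1 / k) * Real.log (k * √(1 - x ^ 2) + √(1 - k ^ 2 * x ^ 2)) with hF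
  set g : ℝ → ℝ := fun x => x * (1 / √((1 - x ^ 2) * (1 - k ^ 2 * x ^ 2))) with hg
  have hq : ∀ x ∈ Icc (0:ℝ) 1, 0 < √(1 - k ^ 2 * x ^ 2) := fun x hx => by
    obtain ⟨h1, h2, h3⟩ := one_sub_sq_mul_sq_mem hk hx
    exact Real.sqrt_pos.2 (by linarith)
  have hcont : ContinuousOn F (Icc 0 1) := by
    refine continuousOn_const.mul (ContinuousOn.log (by fun_prop) fun x hx => ?_)
    have := hq x hx
    positivity
  have hder : ∀ x ∈ Ioo (0:ℝ) 1, HasDerivAt F (g x) x := by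
    intro x hx
    have hx2 : 0 < 1 - x ^ 2 := by nlinarith [hx.1, hx.2]
    have hq0 := hq x ⟨hx.1.le, hx.2.le⟩
    have hp0 := Real.sqrt_pos.2 hx2
    have hq2 := Real.sqrt_pos.1 hq0
    have d1 : HasDerivAt (fun x : ℝ => 1 - x ^ 2) (-(2 * x)) x := by
      simpa using (hasDerivAt_pow 2 x).const_sub 1
    have d2 : HasDerivAt (fun x : ℝ => 1 - k ^ 2 * x ^ 2) (-(k ^ 2 * (2 * x))) x := by
      simpa using ((hasDerivAt_pow 2 x).const_mul (k ^ 2)).const_sub 1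
    have d := ((((d1.sqrt hx2.ne').const_mul k).add (d2.sqrt hq2.ne')).log
      (by simp only [Pi.add_apply]; positivity)).const_mul (-(1 / k))
    refine d.congr_deriv ?_
    simp only [hg, Pi.add_apply]
    rw [Real.sqrt_mul hx2.le]
    field_simp
    ring
  have hint : IntervalIntegrable g volume 0 1 :=
    intervalIntegral.intervalIntegrable_deriv_of_nonneg (by simpa using hcont)
      (fun x hx => hder x (by simpa using hx))
      (fun x hx => mul_nonneg (by simp at hx; exact hx.1.le) (by positivity))
  have hval : ∫ x in (0:ℝ)..1, g x = (Real.log (1 + k) - Real.log (√(1 - k ^ 2))) / k := by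
    rw [intervalIntegral.integral_eq_sub_of_hasDerivAt_of_le zero_le_one hcont hder hint]
    simp [hF]
    rw [add_comm k 1]
    field_simp
    ring
  rw [← hval]
  constructor
  · refine intervalIntegral.integral_mono_on zero_le_one hint (intervalIntegrable_ellK hk)
      fun x hx => ?_
    exact mul_le_of_le_one_left (by positivity) hx.2
  · have h1 : ∫ x in (0:ℝ)..1, (g x + 1) = (∫ x in (0:ℝ)..1, g x) + 1 := by
      rw [intervalIntegral.integral_add hint (by simp)]; simp
    rw [← h1]
    refine intervalIntegral.integral_mono_on zero_le_one (intervalIntegrable_ellK hk)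
      (hint.add (by simp)) fun x hx => ?_
    have hx2 : 0 ≤ 1 - x ^ 2 := by nlinarith [hx.1, hx.2]
    have hq0 := hq x hx
    simp only [hg]
    rcases hx2.eq_or_lt with h | h
    · simp [← h]
    obtain ⟨h1, h2, h3⟩ := one_sub_sq_mul_sq_mem hk hx
    have hxl : x < 1 := by nlinarith [hx.1]
    have : (1 - x) * (1 / √((1 - x ^ 2) * (1 - k ^ 2 * x ^ 2))) ≤ 1 := by
      rw [mul_one_div]
      refine div_le_one_of_le₀ (Real.le_sqrt_of_sq_le ?_) (by positivity)
      have h4 : 1 - x ^ 2 ≤ 1 - k ^ 2 * x ^ 2 := by nlinarith [sq_nonneg x]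
      have h5 : 1 - x ≤ 1 - x ^ 2 := by nlinarith [hx.1]
      nlinarith
    linarith

theorem arcosh_deriv_quotient_lt {c b : ℝ} (hc : 1 < c) (hcb : c < b) (hb : b ≤ 2) :
    (c + 1) * √(c ^ 2 - 1) / (c * √(c ^ 2 + 1)) < (b + 1) * √(b ^ 2 - 1) / (b * √(b ^ 2 + 1)) := by
  have hc0 : 0 < c := by linarith
  have hb0 : 0 < b := by linarith
  have hc2 : 0 ≤ c ^ 2 - 1 := by nlinarith
  have hb2 : 0 ≤ b ^ 2 - 1 := by nlinarith
  refine lt_of_pow_lt_pow_left₀ 2 (by positivity) ?_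
  rw [div_pow, div_pow, mul_pow, mul_pow, mul_pow, mul_pow, Real.sq_sqrt hc2, Real.sq_sqrt hb2,
    Real.sq_sqrt (by positivity), Real.sq_sqrt (by positivity),
    div_lt_div_iff₀ (by positivity) (by positivity)]
  have hp : c * b ≤ 4 := by nlinarith
  have hS : 2 * (c * b) ≤ b ^ 2 + c ^ 2 := by nlinarith [sq_nonneg (b - c)]
  have h1 : 0 ≤ (c * b) ^ 2 * (4 - c * b) := by
    have : 0 ≤ 4 - c * b := by linarith
    positivity
  have h2 : 0 ≤ (c * b) * (b ^ 2 + c ^ 2 - 2 * (c * b)) :=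
    mul_nonneg (by positivity) (by linarith)
  have h3 : 0 < b ^ 2 * c ^ 2 * (b + c) + 2 * (c * b) + (b + c) * (b ^ 2 + c ^ 2) + (b + c) := by
    positivity
  have h4 : 0 < (b - c) * (2 * ((c * b) ^ 2 * (4 - c * b))
      + 2 * ((c * b) * (b ^ 2 + c ^ 2 - 2 * (c * b)))
      + (b ^ 2 * c ^ 2 * (b + c) + 2 * (c * b) + (b + c) * (b ^ 2 + c ^ 2) + (b + c))) :=
    mul_pos (by linarith) (by linarith)
  linarith

theorem one_lt_add_inv_sub_one {c : ℝ} (hc : 1 < c) : 1 < c + c⁻¹ - 1 := by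
  have hc0 : 0 < c := by linarith
  have : c + c⁻¹ - 1 - 1 = (c - 1) ^ 2 / c := by field_simp; ring
  have h2 : 0 < (c - 1) ^ 2 / c := by
    have : 0 < c - 1 := by linarith
    positivity
  linarith

theorem hasDerivAt_arcosh_add_inv {c : ℝ} (hc : 1 < c) :
    HasDerivAt (fun x => Real.arcosh (x + x⁻¹ - 1)) ((c + 1) / (c * √(c ^ 2 + 1))) c := by
  have hc0 : 0 < c := by linarith
  have h1 : HasDerivAt (fun x : ℝ => x + x⁻¹ - 1) (1 + -(c ^ 2)⁻¹) c :=
    ((hasDerivAt_id c).add (hasDerivAt_inv hc0.ne')).sub_const 1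
  have h2 := (Real.hasDerivAt_arcosh (x := c + c⁻¹ - 1) (one_lt_add_inv_sub_one hc)).comp c h1
  refine h2.congr_deriv ?_
  have hc1 : 0 < c - 1 := by linarith
  have e : (c + c⁻¹ - 1) ^ 2 - 1 = ((c - 1) / c) ^ 2 * (c ^ 2 + 1) := by field_simp; ring
  have hs : 0 < √(c ^ 2 + 1) := by positivity
  rw [e, Real.sqrt_mul (sq_nonneg _), Real.sqrt_sq (by positivity)]
  field_simp
  ring

theorem arcosh_add_inv_lt_mul {b : ℝ} (hb : 1 < b) :
    Real.arcosh (b + b⁻¹ - 1) <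
      (b + 1) * √(b ^ 2 - 1) / (b * √(b ^ 2 + 1)) * Real.arcosh b := by
  have hb0 : 0 < b := by linarith
  rcases le_or_gt b 2 with hb2 | hb2
  · set q := (b + 1) * √(b ^ 2 - 1) / (b * √(b ^ 2 + 1)) with hq
    have hder : ∀ c, 1 < c → HasDerivAt (fun x => q * Real.arcosh x - Real.arcosh (x + x⁻¹ - 1))
        (q * (√(c ^ 2 - 1))⁻¹ - (c + 1) / (c * √(c ^ 2 + 1))) c := fun c hc =>
      ((Real.hasDerivAt_arcosh (x := c) hc).const_mul q).sub (hasDerivAt_arcosh_add_inv hc)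
    have hmono : StrictMonoOn (fun x => q * Real.arcosh x - Real.arcosh (x + x⁻¹ - 1))
        (Icc 1 b) := by
      apply strictMonoOn_of_deriv_pos (convex_Icc 1 b)
      · have hin : ContinuousOn (fun x : ℝ => x + x⁻¹ - 1) (Icc 1 b) := by
          refine ContinuousOn.sub (continuousOn_id.add (continuousOn_inv₀.mono ?_))
            continuousOn_const
          intro x hx
          exact (lt_of_lt_of_le one_pos hx.1).ne'
        have hmaps : MapsTo (fun x : ℝ => x + x⁻¹ - 1) (Icc 1 b) (Ici 1) := by
          intro x hx
          rcases hx.1.eq_or_lt with h | h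
          · simp [← h]
          · exact (one_lt_add_inv_sub_one h).le
        exact (continuousOn_const.mul (Real.continuousOn_arcosh.mono Icc_subset_Ici_self)).sub
          (Real.continuousOn_arcosh.comp hin hmaps)
      · intro c hc
        rw [interior_Icc] at hc
        rw [(hder c hc.1).deriv]
        have hlt := arcosh_deriv_quotient_lt hc.1 hc.2 hb2
        have hs : 0 < √(c ^ 2 - 1) := Real.sqrt_pos.2 (by nlinarith [hc.1])
        have : (c + 1) / (c * √(c ^ 2 + 1)) =
            (c + 1) * √(c ^ 2 - 1) / (c * √(c ^ 2 + 1)) * (√(c ^ 2 - 1))⁻¹ := by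
          field_simp
        rw [this, ← sub_mul]
        exact mul_pos (sub_pos.2 hlt) (by positivity)
    have := hmono (left_mem_Icc.2 hb.le) (right_mem_Icc.2 hb.le) hb
    simp at this
    linarith
  · have h1 : Real.arcosh (b + b⁻¹ - 1) < Real.arcosh b := by
      have h1 := one_lt_add_inv_sub_one hb
      refine (Real.arcosh_lt_arcosh (by linarith) hb0).2 ?_
      have := inv_lt_one_of_one_lt₀ hb
      linarith
    have h2 : 1 ≤ (b + 1) * √(b ^ 2 - 1) / (b * √(b ^ 2 + 1)) := by
      have hb3 : 0 ≤ b ^ 2 - 1 := by nlinarith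
      rw [one_le_div (by positivity)]
      refine (sq_le_sq₀ (by positivity) (by positivity)).1 ?_
      rw [mul_pow, mul_pow, Real.sq_sqrt hb3, Real.sq_sqrt (by positivity)]
      nlinarith [mul_pos hb0 hb0, mul_pos (mul_pos hb0 hb0) hb0]
    nlinarith [Real.arcosh_pos hb]

theorem strictMonoOn_arcosh_add_inv_div_arcosh :
    StrictMonoOn (fun c => Real.arcosh (c + c⁻¹ - 1) / Real.arcosh c) (Ioi 1) := by
  have hder : ∀ c : ℝ, 1 < c → HasDerivAt (fun c => Real.arcosh (c + c⁻¹ - 1) / Real.arcosh c)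
      (((c + 1) / (c * √(c ^ 2 + 1)) * Real.arcosh c -
        Real.arcosh (c + c⁻¹ - 1) * (√(c ^ 2 - 1))⁻¹) / Real.arcosh c ^ 2) c := fun c hc =>
    (hasDerivAt_arcosh_add_inv hc).div (Real.hasDerivAt_arcosh (x := c) hc)
      (Real.arcosh_pos hc).ne'
  apply strictMonoOn_of_deriv_pos (convex_Ioi 1)
  · exact fun c hc => (hder c hc).continuousAt.continuousWithinAt
  · intro c hc
    rw [interior_Ioi] at hc
    replace hc : 1 < c := hc
    rw [(hder c hc).deriv]
    have hs : 0 < √(c ^ 2 - 1) := Real.sqrt_pos.2 (by nlinarith)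
    have hB := Real.arcosh_pos hc
    have : (c + 1) / (c * √(c ^ 2 + 1)) =
        (c + 1) * √(c ^ 2 - 1) / (c * √(c ^ 2 + 1)) * (√(c ^ 2 - 1))⁻¹ := by
      field_simp
    refine div_pos ?_ (by positivity)
    rw [this, mul_right_comm, ← sub_mul]
    exact mul_pos (sub_pos.2 (arcosh_add_inv_lt_mul hc)) (by positivity)

theorem arcosh_eq_two_mul_artanh {x : ℝ} (hx : x ∈ Ioo (0:ℝ) 1) :
    Real.arcosh ((1 + x ^ 2) / (1 - x ^ 2)) = 2 * Real.artanh x := by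
  have hx' : x ∈ Ioo (-1:ℝ) 1 := ⟨by linarith [hx.1], hx.2⟩
  have h1 : 0 < 1 - x ^ 2 := by nlinarith [hx.1, hx.2]
  have : (1 + x ^ 2) / (1 - x ^ 2) = Real.cosh (2 * Real.artanh x) := by
    rw [Real.cosh_two_mul, Real.cosh_artanh hx', Real.sinh_artanh hx', div_pow, div_pow,
      Real.sq_sqrt h1.le]
    ring
  rw [this, Real.arcosh_cosh (by linarith [Real.artanh_pos hx])]

theorem arcosh_eq_four_mul_artanh {x : ℝ} (hx : x ∈ Ioo (0:ℝ) 1) :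
    Real.arcosh (2 * ((1 + x ^ 2) / (1 - x ^ 2)) ^ 2 - 1) = 4 * Real.artanh x := by
  have hx2 : x ^ 2 < 1 := by nlinarith [hx.1, hx.2]
  have h1 : 1 ≤ (1 + x ^ 2) / (1 - x ^ 2) := by
    rw [one_le_div (by linarith)]; nlinarith [sq_nonneg x]
  have h2 := arcosh_eq_two_mul_artanh hx
  have h3 : (1 + x ^ 2) / (1 - x ^ 2) = Real.cosh (2 * Real.artanh x) := by
    rw [← h2, Real.cosh_arcosh h1]
  have h4 : 2 * ((1 + x ^ 2) / (1 - x ^ 2)) ^ 2 - 1 = Real.cosh (4 * Real.artanh x) := by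
    rw [h3, show 4 * Real.artanh x = 2 * (2 * Real.artanh x) by ring,
      Real.cosh_two_mul (2 * Real.artanh x), Real.sinh_sq]
    ring
  rw [h4, Real.arcosh_cosh (by linarith [Real.artanh_pos hx])]

/-- The descending Landen transformation. -/
noncomputable def landen (r : ℝ) : ℝ := (r / (1 + √(1 - r ^ 2))) ^ 2

theorem compl_mem {r : ℝ} (hr : r ∈ Ioo (0:ℝ) 1) : √(1 - r ^ 2) ∈ Ioo (0:ℝ) 1 := by
  refine ⟨Real.sqrt_pos.2 (by nlinarith [hr.1, hr.2]), ?_⟩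
  rw [Real.sqrt_lt' one_pos]
  nlinarith [hr.1]

theorem compl_sq {r : ℝ} (hr : r ∈ Ioo (0:ℝ) 1) : √(1 - r ^ 2) ^ 2 = 1 - r ^ 2 :=
  Real.sq_sqrt (by nlinarith [hr.1, hr.2])

theorem compl_lt_compl {r s : ℝ} (hr : r ∈ Ioo (0:ℝ) 1) (hs : s ∈ Ioo (0:ℝ) 1) (hrs : r < s) :
    √(1 - s ^ 2) < √(1 - r ^ 2) :=
  Real.sqrt_lt_sqrt (by nlinarith [hs.1, hs.2]) (by nlinarith [hr.1])

theorem compl_compl_eq {r : ℝ} (hr : r ∈ Ioo (0:ℝ) 1) : √(1 - √(1 - r ^ 2) ^ 2) = r := by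
  rw [compl_sq hr, sub_sub_cancel, Real.sqrt_sq hr.1.le]

theorem landen_eq {r : ℝ} (hr : r ∈ Ioo (0:ℝ) 1) :
    landen r = (1 - √(1 - r ^ 2)) / (1 + √(1 - r ^ 2)) := by
  have h := compl_sq hr
  have h0 := (compl_mem hr).1
  rw [landen, div_pow, div_eq_div_iff (by positivity) (by positivity)]
  linear_combination (1 + √(1 - r ^ 2)) * h

theorem landen_mem {r : ℝ} (hr : r ∈ Ioo (0:ℝ) 1) : landen r ∈ Ioo (0:ℝ) 1 := by
  obtain ⟨h0, h1⟩ := compl_mem hr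
  rw [landen_eq hr]
  exact ⟨div_pos (by linarith) (by linarith), (div_lt_one (by linarith)).2 (by linarith)⟩

theorem landen_le_sq {r : ℝ} (hr : r ∈ Ioo (0:ℝ) 1) : landen r ≤ r * r := by
  have h0 := (compl_mem hr).1
  rw [landen, ← sq]
  have := hr.1
  gcongr
  exact div_le_self hr.1.le (by linarith)

theorem landen_lt_landen {r s : ℝ} (hr : r ∈ Ioo (0:ℝ) 1) (hs : s ∈ Ioo (0:ℝ) 1) (hrs : r < s) :
    landen r < landen s := by
  have h := compl_lt_compl hr hs hrs
  have h0 := (compl_mem hs).1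
  have hr0 := hr.1
  have hs0 := hs.1
  rw [landen, landen]
  gcongr

theorem compl_landen {r : ℝ} (hr : r ∈ Ioo (0:ℝ) 1) :
    √(1 - landen r ^ 2) = 2 * √(√(1 - r ^ 2)) / (1 + √(1 - r ^ 2)) := by
  have h0 := (compl_mem hr).1
  rw [Real.sqrt_eq_iff_eq_sq _ (by positivity), landen_eq hr, div_pow, div_pow, mul_pow,
    Real.sq_sqrt h0.le]
  · field_simp; ring
  · have := landen_mem hr
    nlinarith [this.1, this.2]

theorem ascending_landen {r : ℝ} (hr : r ∈ Ioo (0:ℝ) 1) :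
    2 * √(landen r) / (1 + landen r) = r := by
  have h0 := (compl_mem hr).1
  have hr0 := hr.1
  have h1 : √(landen r) = r / (1 + √(1 - r ^ 2)) := by
    rw [landen, Real.sqrt_sq (by positivity)]
  rw [h1, landen_eq hr]
  field_simp
  ring

theorem mu_pos {r : ℝ} (hr : r ∈ Ioo (0:ℝ) 1) : 0 < mu r := by
  have h1 := ellK_pos hr
  have h2 := ellK_pos (compl_mem hr)
  have := Real.pi_pos
  rw [mu]; positivity

theorem mu_landen {r : ℝ} (hr : r ∈ Ioo (0:ℝ) 1) : mu (landen r) = 2 * mu r := by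
  have h0 := (compl_mem hr).1
  have h1 := ellK_ascending_landen (landen_mem hr)
  have h2 := ellK_ascending_landen (compl_mem hr)
  have h3 := ellK_pos (landen_mem hr)
  have h4 := (landen_mem hr).1
  rw [ascending_landen hr] at h1
  rw [mu, mu, compl_landen hr, h2, h1, landen_eq hr]
  rw [landen_eq hr] at h3
  field_simp
  ring

theorem mu_le_mu {r s : ℝ} (hr : r ∈ Ioo (0:ℝ) 1) (hs : s ∈ Ioo (0:ℝ) 1) (hrs : r ≤ s) :
    mu s ≤ mu r := by
  have h1 := ellK_le_ellK hr hs hrs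
  have h2 := ellK_le_ellK (compl_mem hs) (compl_mem hr)
    (Real.sqrt_le_sqrt (by nlinarith [hr.1]))
  have h3 := ellK_pos hr
  have h4 := ellK_pos (compl_mem hr)
  have := Real.pi_pos
  rw [mu, mu]
  gcongr

theorem strictAntiOn_of_landen_quotient {g : ℝ → ℝ} (hpos : ∀ r ∈ Ioo (0:ℝ) 1, 0 < g r)
    (hlim : Tendsto g (𝓝[>] 0) (𝓝 1))
    (hmono : StrictMonoOn (fun r => g (landen r) / g r) (Ioo 0 1)) :
    StrictAntiOn g (Ioo 0 1) := by
  have hmem : ∀ r ∈ Ioo (0:ℝ) 1, ∀ n : ℕ, landen^[n] r ∈ Ioo (0:ℝ) 1 := by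
    intro r hr n
    induction n with
    | zero => exact hr
    | succ n ih => rw [Function.iterate_succ_apply']; exact landen_mem ih
  have hle : ∀ r ∈ Ioo (0:ℝ) 1, ∀ n : ℕ, landen^[n] r ≤ r ^ (n + 1) := by
    intro r hr n
    induction n with
    | zero => simp
    | succ n ih =>
      rw [Function.iterate_succ_apply', pow_succ]
      have h := hmem r hr n
      have h2 : landen^[n] r ≤ r :=
        ih.trans (pow_le_of_le_one hr.1.le hr.2.le (Nat.succ_ne_zero n))
      exact (landen_le_sq h).trans (mul_le_mul ih h2 h.1.le (pow_nonneg hr.1.le _))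
  have hto : ∀ r ∈ Ioo (0:ℝ) 1, Tendsto (fun n : ℕ => g (landen^[n] r)) atTop (𝓝 1) := by
    intro r hr
    refine hlim.comp (tendsto_nhdsWithin_iff.2 ⟨?_, Eventually.of_forall fun n => (hmem r hr n).1⟩)
    exact squeeze_zero (fun n => (hmem r hr n).1.le) (hle r hr)
      ((tendsto_pow_atTop_nhds_zero_of_lt_one hr.1.le hr.2).comp (tendsto_add_atTop_nat 1))
  intro r hr s hs hrs
  have hlt : ∀ n : ℕ, landen^[n] r < landen^[n] s := by
    intro n
    induction n with
    | zero => exact hrs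
    | succ n ih =>
      rw [Function.iterate_succ_apply', Function.iterate_succ_apply']
      exact landen_lt_landen (hmem r hr n) (hmem s hs n) ih
  set ρ : ℕ → ℝ := fun n => g (landen^[n] s) / g (landen^[n] r) with hρ
  have hρmono : StrictMono ρ := by
    refine strictMono_nat_of_lt_succ fun n => ?_
    have h := hmono (hmem r hr n) (hmem s hs n) (hlt n)
    have p1 := hpos _ (hmem r hr n)
    have p2 := hpos _ (hmem s hs n)
    have p3 := hpos _ (hmem r hr (n + 1))
    simp only [hρ]
    simp only [Function.iterate_succ_apply'] at p3 ⊢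
    simp only at h
    rw [div_lt_div_iff₀ p1 p2] at h
    rw [div_lt_div_iff₀ p1 p3]
    linarith
  have hρlim : Tendsto ρ atTop (𝓝 1) := by
    have := (hto s hs).div (hto r hr) one_ne_zero
    rwa [div_one] at this
  have : ρ 0 < 1 := (hρmono one_pos).trans_le (hρmono.monotone.ge_of_tendsto hρlim 1)
  exact (div_lt_one (hpos r hr)).1 this

theorem artanh_eq_real_artanh {x : ℝ} (hx : x ∈ Ioo (0:ℝ) 1) : artanh x = Real.artanh x := by
  rw [Real.artanh_eq_half_log ⟨by linarith [hx.1], hx.2.le⟩, artanh]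
  ring

theorem compl_rpow_mem {r : ℝ} (hr : r ∈ Ioo (0:ℝ) 1) :
    (1 - r ^ 2) ^ ((1:ℝ) / 8) ∈ Ioo (0:ℝ) 1 := by
  have h : 0 < 1 - r ^ 2 := by nlinarith [hr.1, hr.2]
  refine ⟨Real.rpow_pos_of_pos h _, Real.rpow_lt_one h.le ?_ (by norm_num)⟩
  nlinarith [hr.1]

theorem compl_rpow_pow {r : ℝ} (hr : r ∈ Ioo (0:ℝ) 1) :
    ((1 - r ^ 2) ^ ((1:ℝ) / 8)) ^ 8 = 1 - r ^ 2 := by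
  have h : 0 ≤ 1 - r ^ 2 := by nlinarith [hr.1, hr.2]
  rw [one_div]
  exact Real.rpow_inv_natCast_pow (n := 8) h (by norm_num)

theorem compl_rpow_pow_four {r : ℝ} (hr : r ∈ Ioo (0:ℝ) 1) :
    √(1 - r ^ 2) = ((1 - r ^ 2) ^ ((1:ℝ) / 8)) ^ 4 := by
  have h : 0 ≤ 1 - r ^ 2 := by nlinarith [hr.1, hr.2]
  rw [Real.sqrt_eq_iff_eq_sq h (pow_nonneg (compl_rpow_mem hr).1.le _)]
  linear_combination -compl_rpow_pow hr

theorem artanh_compl_rpow_pos {r : ℝ} (hr : r ∈ Ioo (0:ℝ) 1) :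
    0 < artanh ((1 - r ^ 2) ^ ((1:ℝ) / 8)) := by
  rw [artanh_eq_real_artanh (compl_rpow_mem hr)]
  exact Real.artanh_pos (compl_rpow_mem hr)

theorem landen_quotient_artanh {r : ℝ} (hr : r ∈ Ioo (0:ℝ) 1) {g c : ℝ}
    (hg : g = (1 - landen r ^ 2) ^ ((1:ℝ) / 8)) (hc : c = (1 + g ^ 2) / (1 - g ^ 2)) :
    artanh g = Real.arcosh c / 2 ∧
      artanh ((1 - r ^ 2) ^ ((1:ℝ) / 8)) = Real.arcosh (c + c⁻¹ - 1) / 4 := by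
  have hL := landen_mem hr
  have hgm : g ∈ Ioo (0:ℝ) 1 := hg ▸ compl_rpow_mem hL
  have htm := compl_rpow_mem hr
  have h4 := compl_rpow_pow_four hL
  rw [compl_landen hr, ← hg, compl_rpow_pow_four hr] at h4
  rw [artanh_eq_real_artanh hgm, artanh_eq_real_artanh htm]
  set t := (1 - r ^ 2) ^ ((1:ℝ) / 8)
  have hst : √(t ^ 4) = t ^ 2 := by
    rw [show t ^ 4 = (t ^ 2) ^ 2 by ring, Real.sqrt_sq (sq_nonneg _)]
  rw [hst] at h4
  have hg2 : 0 < 1 - g ^ 2 := by nlinarith [hgm.1, hgm.2]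
  have ht2 : 0 < 1 - t ^ 2 := by nlinarith [htm.1, htm.2]
  refine ⟨by rw [hc, arcosh_eq_two_mul_artanh hgm]; ring, ?_⟩
  have hcc : c + c⁻¹ - 1 = 2 * ((1 + t ^ 2) / (1 - t ^ 2)) ^ 2 - 1 := by
    have h5 : g ^ 4 * (1 + t ^ 4) = 2 * t ^ 2 := by rw [← h4]; field_simp
    have h6 : c + c⁻¹ = 2 * (1 + g ^ 4) / (1 - g ^ 4) := by
      rw [hc, inv_div, show 1 - g ^ 4 = (1 - g ^ 2) * (1 + g ^ 2) by ring]
      field_simp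
      ring
    have hg4 : 0 < 1 - g ^ 4 := by
      rw [show 1 - g ^ 4 = (1 - g ^ 2) * (1 + g ^ 2) by ring]; positivity
    rw [h6, div_pow, ← mul_div_assoc, sub_left_inj, div_eq_div_iff (by positivity) (by positivity)]
    linear_combination 4 * h5
  rw [hcc, arcosh_eq_four_mul_artanh htm]
  ring

theorem strictMonoOn_artanh_landen_quotient :
    StrictMonoOn (fun r => artanh ((1 - landen r ^ 2) ^ ((1:ℝ) / 8)) /
      artanh ((1 - r ^ 2) ^ ((1:ℝ) / 8))) (Ioo 0 1) := by
  intro r hr s hs hrs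
  have hLr := landen_mem hr
  have hLs := landen_mem hs
  obtain ⟨r1, r2⟩ := landen_quotient_artanh hr rfl rfl
  obtain ⟨s1, s2⟩ := landen_quotient_artanh hs rfl rfl
  have hgr := compl_rpow_mem hLr
  have hgs := compl_rpow_mem hLs
  have hlt : (1 - landen s ^ 2) ^ ((1:ℝ) / 8) < (1 - landen r ^ 2) ^ ((1:ℝ) / 8) := by
    refine Real.rpow_lt_rpow (by nlinarith [hLs.1, hLs.2]) ?_ (by norm_num)
    nlinarith [landen_lt_landen hr hs hrs, hLr.1, hLs.1]
  simp only [r1, r2, s1, s2]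
  have one_lt : ∀ x ∈ Ioo (0:ℝ) 1, 1 < (1 + x ^ 2) / (1 - x ^ 2) := fun x hx => by
    rw [one_lt_div (by nlinarith [hx.1, hx.2])]; nlinarith [hx.1]
  have hcr := one_lt _ hgr
  have hcs := one_lt _ hgs
  generalize (1 - landen s ^ 2) ^ ((1:ℝ) / 8) = y at *
  generalize (1 - landen r ^ 2) ^ ((1:ℝ) / 8) = x at *
  have hcc : (1 + y ^ 2) / (1 - y ^ 2) < (1 + x ^ 2) / (1 - x ^ 2) := by
    rw [div_lt_div_iff₀ (by nlinarith [hgs.1, hgs.2]) (by nlinarith [hgr.1, hgr.2])]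
    nlinarith [hgs.1]
  have h := strictMonoOn_arcosh_add_inv_div_arcosh hcs hcr hcc
  simp only at h
  generalize (1 + y ^ 2) / (1 - y ^ 2) = b at *
  generalize (1 + x ^ 2) / (1 - x ^ 2) = a at *
  have p1 := Real.arcosh_pos hcr
  have p2 := Real.arcosh_pos hcs
  have p3 := Real.arcosh_pos (one_lt_add_inv_sub_one hcr)
  have p4 := Real.arcosh_pos (one_lt_add_inv_sub_one hcs)
  rw [div_lt_div_iff₀ p2 p1] at h
  rw [div_lt_div_iff₀ (by positivity) (by positivity)]
  linarith

theorem log_four_div_pos {r : ℝ} (hr : r ∈ Ioo (0:ℝ) 1) : 0 < Real.log (4 / r) := by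
  refine Real.log_pos ((one_lt_div hr.1).2 ?_)
  linarith [hr.2]

theorem log_four_div_landen {r : ℝ} (hr : r ∈ Ioo (0:ℝ) 1) :
    Real.log (4 / landen r) = 2 * Real.log (2 * (1 + √(1 - r ^ 2)) / r) := by
  have h0 := (compl_mem hr).1
  have hr0 := hr.1
  have : 4 / landen r = (2 * (1 + √(1 - r ^ 2)) / r) ^ 2 := by
    rw [landen]; field_simp; norm_num
  rw [this, Real.log_pow]
  norm_num

theorem log_eq_log_four_div_sub {r : ℝ} (hr : r ∈ Ioo (0:ℝ) 1) :
    Real.log (2 * (1 + √(1 - r ^ 2)) / r) =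
      Real.log (4 / r) - Real.log (2 / (1 + √(1 - r ^ 2))) := by
  have h0 := (compl_mem hr).1
  have hr0 := hr.1
  rw [← Real.log_div (by positivity) (by positivity)]
  congr 1
  field_simp
  norm_num

theorem strictMonoOn_log_landen_quotient :
    StrictMonoOn (fun r => Real.log (4 / r) / Real.log (4 / landen r)) (Ioo 0 1) := by
  intro r hr s hs hrs
  have h1 := log_four_div_pos (landen_mem hr)
  have h2 := log_four_div_pos (landen_mem hs)
  have h3 := log_four_div_pos hr
  have h4 := log_four_div_pos hs
  have hr0 := hr.1
  have hs0 := hs.1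
  have hr1 := compl_mem hr
  have hs1 := compl_mem hs
  have hrs' := compl_lt_compl hr hs hrs
  have h5 : Real.log (4 / s) < Real.log (4 / r) := Real.log_lt_log (by positivity) (by gcongr)
  have h6 : 0 < Real.log (2 / (1 + √(1 - r ^ 2))) :=
    Real.log_pos ((one_lt_div (by linarith [hr1.1])).2 (by linarith [hr1.2]))
  have h7 : Real.log (2 / (1 + √(1 - r ^ 2))) < Real.log (2 / (1 + √(1 - s ^ 2))) := by
    have := hs1.1
    have := hr1.1
    exact Real.log_lt_log (by positivity) (by gcongr)
  simp only
  rw [div_lt_div_iff₀ h1 h2, log_four_div_landen hr, log_four_div_landen hs,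
    log_eq_log_four_div_sub hr, log_eq_log_four_div_sub hs]
  nlinarith [mul_lt_mul h5 h7.le h6 h3.le]

theorem tendsto_log_four_div : Tendsto (fun r : ℝ => Real.log (4 / r)) (𝓝[>] 0) atTop :=
  Real.tendsto_log_atTop.comp (Tendsto.const_mul_atTop four_pos tendsto_inv_nhdsGT_zero)

theorem eventually_mem_Ioo : ∀ᶠ r : ℝ in 𝓝[>] 0, r ∈ Ioo (0:ℝ) 1 :=
  Ioo_mem_nhdsGT one_pos

theorem tendsto_compl : Tendsto (fun r : ℝ => √(1 - r ^ 2)) (𝓝[>] 0) (𝓝 1) := by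
  have : ContinuousAt (fun r : ℝ => √(1 - r ^ 2)) 0 := by fun_prop
  simpa [ContinuousAt] using this.tendsto.mono_left nhdsWithin_le_nhds

theorem tendsto_ellK : Tendsto ellK (𝓝[>] 0) (𝓝 (Real.pi / 2)) := by
  have h : Tendsto (fun r : ℝ => 1 / √(1 - r ^ 2) * (Real.pi / 2)) (𝓝[>] 0) (𝓝 (Real.pi / 2)) := by
    simpa using (tendsto_compl.inv₀ one_ne_zero).mul_const (Real.pi / 2)
  exact tendsto_of_tendsto_of_tendsto_of_le_of_le' tendsto_const_nhds h
    (eventually_mem_Ioo.mono fun r hr => pi_div_two_le_ellK hr)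
    (eventually_mem_Ioo.mono fun r hr => ellK_le hr)

theorem tendsto_ellK_compl_div_log :
    Tendsto (fun r => ellK √(1 - r ^ 2) / Real.log (4 / r)) (𝓝[>] 0) (𝓝 1) := by
  have hA : Tendsto (fun r : ℝ => (1 + (Real.log (1 + √(1 - r ^ 2)) - Real.log 4) /
      Real.log (4 / r)) / √(1 - r ^ 2)) (𝓝[>] 0) (𝓝 1) := by
    have h1 : Tendsto (fun r : ℝ => Real.log (1 + √(1 - r ^ 2)) - Real.log 4) (𝓝[>] 0)
        (𝓝 (Real.log (1 + 1) - Real.log 4)) :=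
      ((tendsto_compl.const_add 1).log (by norm_num)).sub_const _
    have h2 := ((h1.div_atTop tendsto_log_four_div).const_add 1).div tendsto_compl one_ne_zero
    rwa [add_zero, div_one] at h2
  have hB := hA.add (tendsto_const_nhds (x := (1:ℝ)) |>.div_atTop tendsto_log_four_div)
  rw [add_zero] at hB
  have key : ∀ r ∈ Ioo (0:ℝ) 1, (1 + (Real.log (1 + √(1 - r ^ 2)) - Real.log 4) /
      Real.log (4 / r)) / √(1 - r ^ 2) =
      (Real.log (1 + √(1 - r ^ 2)) - Real.log r) / √(1 - r ^ 2) / Real.log (4 / r) := by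
    intro r hr
    have hw := log_four_div_pos hr
    have h0 := (compl_mem hr).1
    rw [Real.log_div four_ne_zero hr.1.ne'] at hw ⊢
    field_simp
    ring
  refine tendsto_of_tendsto_of_tendsto_of_le_of_le' hA hB
    (eventually_mem_Ioo.mono fun r hr => ?_) (eventually_mem_Ioo.mono fun r hr => ?_)
  · have hw := log_four_div_pos hr
    have h := (ellK_bounds_log (compl_mem hr)).1
    rw [compl_compl_eq hr] at h
    rw [key r hr]
    gcongr
  · have hw := log_four_div_pos hr
    have h := (ellK_bounds_log (compl_mem hr)).2
    rw [compl_compl_eq hr] at h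
    rw [key r hr, ← add_div]
    gcongr

theorem tendsto_mu_div_log : Tendsto (fun r => mu r / Real.log (4 / r)) (𝓝[>] 0) (𝓝 1) := by
  have h := (tendsto_ellK_compl_div_log.const_mul (Real.pi / 2)).div tendsto_ellK
    Real.pi_div_two_pos.ne'
  rw [mul_one, div_self Real.pi_div_two_pos.ne'] at h
  refine h.congr fun r => ?_
  simp only [Pi.div_apply, mu]
  ring

theorem artanh_compl_rpow_eq {r t : ℝ} (hr : r ∈ Ioo (0:ℝ) 1)
    (ht : t = (1 - r ^ 2) ^ ((1:ℝ) / 8)) :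
    artanh t = Real.log (4 / r) +
      (Real.log ((1 + t) ^ 2 * (1 + t ^ 2) * (1 + t ^ 4)) / 2 - Real.log 4) := by
  have htm : t ∈ Ioo (0:ℝ) 1 := ht ▸ compl_rpow_mem hr
  have h8 : t ^ 8 = 1 - r ^ 2 := ht ▸ compl_rpow_pow hr
  have ht0 := htm.1
  have hr0 := hr.1
  have h1 : 0 < 1 - t := by linarith [htm.2]
  have : (1 + t) / (1 - t) = (1 + t) ^ 2 * (1 + t ^ 2) * (1 + t ^ 4) / r ^ 2 := by
    rw [div_eq_div_iff (by positivity) (by positivity)]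
    linear_combination (1 + t) * h8
  rw [artanh, this, Real.log_div (by positivity) (by positivity), Real.log_pow,
    Real.log_div (by norm_num) hr0.ne']
  push_cast
  ring

theorem tendsto_artanh_div_log :
    Tendsto (fun r => artanh ((1 - r ^ 2) ^ ((1:ℝ) / 8)) / Real.log (4 / r)) (𝓝[>] 0) (𝓝 1) := by
  have ht : Tendsto (fun r : ℝ => (1 - r ^ 2) ^ ((1:ℝ) / 8)) (𝓝[>] 0) (𝓝 1) := by
    have : ContinuousAt (fun r : ℝ => (1 - r ^ 2) ^ ((1:ℝ) / 8)) 0 :=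
      ContinuousAt.rpow_const (by fun_prop) (by norm_num)
    simpa [ContinuousAt] using this.tendsto.mono_left nhdsWithin_le_nhds
  have hlog : ContinuousAt (fun t : ℝ => Real.log ((1 + t) ^ 2 * (1 + t ^ 2) * (1 + t ^ 4)) / 2
      - Real.log 4) 1 :=
    ((ContinuousAt.log (by fun_prop) (by norm_num)).div_const 2).sub_const _
  have h := ((hlog.tendsto.comp ht).div_atTop tendsto_log_four_div).const_add 1
  rw [add_zero] at h
  refine h.congr' (eventually_mem_Ioo.mono fun r hr => ?_)
  have hw := log_four_div_pos hr
  beta_reduce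
  rw [artanh_compl_rpow_eq hr rfl, add_div, div_self hw.ne']
  rfl

theorem strictAntiOn_artanh_div_mu :
    StrictAntiOn (fun r => artanh ((1 - r ^ 2) ^ ((1:ℝ) / 8)) / mu r) (Ioo 0 1) := by
  refine strictAntiOn_of_landen_quotient
    (fun r hr => div_pos (artanh_compl_rpow_pos hr) (mu_pos hr)) ?_ ?_
  · have h := tendsto_artanh_div_log.div tendsto_mu_div_log one_ne_zero
    rw [div_one] at h
    refine h.congr' (eventually_mem_Ioo.mono fun r hr => ?_)
    exact div_div_div_cancel_right₀ (log_four_div_pos hr).ne' _ _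
  · intro r hr s hs hrs
    have h := strictMonoOn_artanh_landen_quotient hr hs hrs
    have m1 := mu_pos hr
    have m2 := mu_pos hs
    simp only at h ⊢
    rw [mu_landen hr, mu_landen hs]
    have e : ∀ a b m : ℝ, 0 < m → a / (2 * m) / (b / m) = a / b / 2 := fun a b m hm => by
      field_simp
    rw [e _ _ _ m1, e _ _ _ m2]
    linarith

theorem strictAntiOn_mu_div_log :
    StrictAntiOn (fun r => mu r / Real.log (4 / r)) (Ioo 0 1) := by
  refine strictAntiOn_of_landen_quotient
    (fun r hr => div_pos (mu_pos hr) (log_four_div_pos hr)) tendsto_mu_div_log ?_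
  intro r hr s hs hrs
  have h := strictMonoOn_log_landen_quotient hr hs hrs
  have m1 := mu_pos hr
  have m2 := mu_pos hs
  simp only at h ⊢
  rw [mu_landen hr, mu_landen hs]
  have e : ∀ a b m : ℝ, 0 < m → 2 * m / b / (m / a) = 2 * (a / b) := fun a b m hm => by
    field_simp
  rw [e _ _ _ m1, e _ _ _ m2]
  linarith

theorem sqrt_one_sub_tanh_pow_lt {s y : ℝ} (hs : s ∈ Ioo (0:ℝ) 1)
    (hy : artanh ((1 - s ^ 2) ^ ((1:ℝ) / 8)) < y) : √(1 - Real.tanh y ^ 8) < s := by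
  have hm := compl_rpow_mem hs
  have h8 := compl_rpow_pow hs
  rw [artanh_eq_real_artanh hm] at hy
  have hlt : (1 - s ^ 2) ^ ((1:ℝ) / 8) < Real.tanh y := by
    by_contra! hle
    have := Real.artanh_le_artanh (Real.neg_one_lt_tanh y) hm.2 hle
    rw [Real.artanh_tanh] at this
    linarith
  have := pow_lt_pow_left₀ hlt hm.1.le (by norm_num : (8:ℕ) ≠ 0)
  rw [Real.sqrt_lt' hs.1]
  linarith

theorem lt_of_lt_log {s y : ℝ} (hs : s ∈ Ioo (0:ℝ) 1) (h2 : Real.log 2 ≤ y)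
    (hy : y < Real.log (2 * (1 + √(1 - s ^ 2)) / s)) :
    s < 4 * Real.exp y / (Real.exp (2 * y) + 4) := by
  have h0 := (compl_mem hs).1
  have hs0 := hs.1
  have hsq := compl_sq hs
  have hE : 2 ≤ Real.exp y := by rwa [← Real.log_le_iff_le_exp two_pos]
  have hX : Real.exp y < 2 * (1 + √(1 - s ^ 2)) / s := by
    rwa [← Real.lt_log_iff_exp_lt (by positivity)]
  set X := 2 * (1 + √(1 - s ^ 2)) / s with hXdef
  have hsX : s * (X ^ 2 + 4) = 4 * X := by
    rw [hXdef]
    field_simp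
    linear_combination 4 * hsq
  have he : Real.exp (2 * y) = Real.exp y ^ 2 := by rw [two_mul, Real.exp_add, sq]
  rw [he, lt_div_iff₀ (by positivity)]
  set E := Real.exp y
  have hneg : 0 < (X - E) * (E * X - 4) := mul_pos (by linarith) (by nlinarith)
  have h4 : (s * (E ^ 2 + 4)) * (X ^ 2 + 4) < (4 * E) * (X ^ 2 + 4) := by
    have : (s * (E ^ 2 + 4)) * (X ^ 2 + 4) = 4 * X * (E ^ 2 + 4) := by rw [← hsX]; ring
    rw [this]
    linarith
  exact lt_of_mul_lt_mul_right h4 (by positivity)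

end

theorem phiK_bounds_u1_v2 (K : ℝ) (hK : 1 < K) (r : ℝ) (hr : r ∈ Set.Ioo (0:ℝ) 1)
    (s : ℝ) (hs : s ∈ Set.Ioo (0:ℝ) 1) (hμs : mu s = mu r / K) :
    Real.sqrt (1 - Real.tanh (artanh ((1 - r ^ 2) ^ ((1:ℝ)/8)) / K) ^ 8) < s ∧
      (Real.log 2 ≤ Real.log (2 * (1 + Real.sqrt (1 - r ^ 2)) / r) / K →
        s < 4 * Real.exp (Real.log (2 * (1 + Real.sqrt (1 - r ^ 2)) / r) / K) /
          (Real.exp (2 * (Real.log (2 * (1 + Real.sqrt (1 - r ^ 2)) / r) / K)) + 4)) := by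
  have hK0 : 0 < K := by linarith
  have mr := mu_pos hr
  have hrs : r < s := by
    by_contra! hle
    have := mu_le_mu hs hr hle
    have := div_lt_self mr hK
    linarith
  constructor
  · apply sqrt_one_sub_tanh_pow_lt hs
    have h := strictAntiOn_artanh_div_mu hr hs hrs
    simp only at h
    rw [hμs, div_lt_div_iff₀ (by positivity) mr, ← mul_div_assoc, lt_div_iff₀ hK0] at h
    rw [lt_div_iff₀ hK0]
    refine lt_of_mul_lt_mul_right ?_ mr.le
    linarith
  · intro h2
    apply lt_of_lt_log hs h2
    have hLr := landen_mem hr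
    have hLs := landen_mem hs
    have h := strictAntiOn_mu_div_log hLr hLs (landen_lt_landen hr hs hrs)
    simp only at h
    rw [div_lt_div_iff₀ (log_four_div_pos hLs) (log_four_div_pos hLr), mu_landen hr, mu_landen hs,
      log_four_div_landen hr, log_four_div_landen hs, hμs] at h
    refine lt_of_mul_lt_mul_right ?_ mr.le
    have e : Real.log (2 * (1 + √(1 - r ^ 2)) / r) / K * mu r =
        mu r / K * Real.log (2 * (1 + √(1 - r ^ 2)) / r) := by ring
    linarith
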